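/- Let U ∈ ℝ^{3×3} be symmetric and positive definite, and let W : ℝ^{3×3} → [0,∞] be frame indifferent, C² near SO(3)·U, vanishing exactly on SO(3)·U, and satisfying W(F) ≥ C·dist²(F, SO(3)·U) near the well. Then the quadratic form Q(A) = D²W(U)[A,A] satisfies Q(U⁻¹ sym(A)) ≥ λ |sym(A)|² for some λ > 0 and all A ∈ ℝ^{3×3}. -/

import Mathlib

open Matrix Metric

attribute [local instance] Matrix.frobeniusNormedAddCommGroup Matrix.frobeniusNormedSpace

noncomputable def symPart (A : Matrix (Fin 3) (Fin 3) ℝ) : Matrix (Fin 3) (Fin 3) ℝ :=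
  (1 / 2 : ℝ) • (A + Aᵀ)

/-- The energy well `SO(3)·U`. -/
def well (U : Matrix (Fin 3) (Fin 3) ℝ) : Set (Matrix (Fin 3) (Fin 3) ℝ) :=
  {F | ∃ R ∈ Matrix.specialOrthogonalGroup (Fin 3) ℝ, F = R * U}

open Filter Topology in
lemma taylor_aux (f f' : ℝ → ℝ) (q : ℝ) (hf : ∀ᶠ t in 𝓝 (0:ℝ), HasDerivAt f (f' t) t)
    (hf' : HasDerivAt f' q 0) (h0 : f 0 = 0) (h0' : f' 0 = 0) :
    Tendsto (fun t => f t / t ^ 2) (𝓝[>] 0) (𝓝 (q / 2)) := by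
  apply HasDerivAt.lhopital_zero_nhdsGT (f' := f') (g' := fun t => 2 * t)
  · exact nhdsWithin_le_nhds hf
  · filter_upwards with t
    simpa using hasDerivAt_pow 2 t
  · filter_upwards [self_mem_nhdsWithin] with t ht
    have : (0:ℝ) < t := ht
    positivity
  · have := hf.self_of_nhds.continuousAt.tendsto
    rw [h0] at this
    exact this.mono_left nhdsWithin_le_nhds
  · have : Tendsto (fun t : ℝ => t ^ 2) (𝓝 0) (𝓝 (0 ^ 2)) := (continuous_pow 2).tendsto 0
    simp only [ne_eq, OfNat.ofNat_ne_zero, not_false_eq_true, zero_pow] at this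
    exact this.mono_left nhdsWithin_le_nhds
  · have h := (hasDerivAt_iff_tendsto_slope.1 hf').mono_left
      (nhdsWithin_mono (0:ℝ) (t := {0}ᶜ) (s := Set.Ioi 0) (by intro x hx; exact ne_of_gt hx))
    have h2 := h.div_const 2
    refine h2.congr ?_
    intro t
    simp only [slope_def_field, h0', sub_zero]
    rw [div_div, mul_comm t 2]

open Filter Topology in
lemma taylor_gen {E : Type*} [NormedAddCommGroup E] [NormedSpace ℝ E] (W : E → ℝ) (U B : E)
    (hWat : ContDiffAt ℝ 2 W U) (hnonneg : ∀ F, 0 ≤ W F) (hWU : W U = 0) :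
    Tendsto (fun t : ℝ => U + t • B) (𝓝 0) (𝓝 U) ∧
    Tendsto (fun t : ℝ => W (U + t • B) / t ^ 2) (𝓝[>] 0)
      (𝓝 (iteratedFDeriv ℝ 2 W U ![B, B] / 2)) := by
  rw [iteratedFDeriv_two_apply]
  simp only [Matrix.cons_val_zero, Matrix.cons_val_one]
  have hD1 : ∀ᶠ F in 𝓝 U, DifferentiableAt ℝ W F := by
    filter_upwards [hWat.eventually (by simp)] with F hF
    exact hF.differentiableAt (by simp)
  have hD2 : DifferentiableAt ℝ (fderiv ℝ W) U :=
    (hWat.fderiv_right (m := 1) (by norm_num)).differentiableAt (by simp)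
  have hgrad : fderiv ℝ W U = 0 := by
    apply IsLocalMin.fderiv_eq_zero
    filter_upwards with F
    rw [hWU]; exact hnonneg F
  have hline : ∀ t : ℝ, HasDerivAt (fun t : ℝ => U + t • B) B t := fun t => by
    simpa using! ((hasDerivAt_id t).smul_const B).const_add U
  have hl0 : U + (0:ℝ) • B = U := by simp
  have hcont : Tendsto (fun t : ℝ => U + t • B) (𝓝 0) (𝓝 U) := by
    have := (hline 0).continuousAt.tendsto
    rwa [hl0] at this
  have hT := taylor_aux (fun t => W (U + t • B)) (fun t => fderiv ℝ W (U + t • B) B)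
    (fderiv ℝ (fderiv ℝ W) U B B)
    (by
      filter_upwards [hcont.eventually hD1] with t ht
      exact ht.hasFDerivAt.comp_hasDerivAt t (hline t))
    (by
      have h1 : HasFDerivAt (fderiv ℝ W) (fderiv ℝ (fderiv ℝ W) U) (U + (0:ℝ) • B) := by
        rw [hl0]; exact hD2.hasFDerivAt
      have h2 := h1.comp_hasDerivAt (0:ℝ) (hline 0)
      simpa using h2.clm_apply (hasDerivAt_const (0:ℝ) B))
    (by simp [hWU]) (by simp [hgrad])
  exact ⟨hcont, hT⟩

lemma frob_sq (G : Matrix (Fin 3) (Fin 3) ℝ) : ‖G‖ ^ 2 = (Gᵀ * G).trace := by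
  rw [Matrix.frobenius_norm_def, ← Real.sqrt_eq_rpow, Real.sq_sqrt (by positivity)]
  simp only [Matrix.trace, Matrix.diag, Matrix.mul_apply, Matrix.transpose_apply]
  rw [Finset.sum_comm]
  simp [pow_two]

lemma well_gram {U G : Matrix (Fin 3) (Fin 3) ℝ} (hG : G ∈ well U) : Gᵀ * G = Uᵀ * U := by
  obtain ⟨R, hR, rfl⟩ := hG
  have h1 : Rᵀ * R = 1 := by
    have := (Matrix.mem_specialOrthogonalGroup_iff.1 hR).1
    rw [Matrix.mem_orthogonalGroup_iff'] at this
    simpa [Matrix.star_eq_conjTranspose] using this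
  rw [Matrix.transpose_mul, Matrix.mul_assoc, ← Matrix.mul_assoc Rᵀ, h1, Matrix.one_mul]

lemma well_norm {U G : Matrix (Fin 3) (Fin 3) ℝ} (hG : G ∈ well U) : ‖G‖ = ‖U‖ := by
  have : ‖G‖ ^ 2 = ‖U‖ ^ 2 := by rw [frob_sq, frob_sq, well_gram hG]
  exact (sq_eq_sq₀ (norm_nonneg _) (norm_nonneg _)).1 this

lemma self_mem_well (U : Matrix (Fin 3) (Fin 3) ℝ) : U ∈ well U :=
  ⟨1, one_mem _, by simp⟩

lemma dist_bound (U S B : Matrix (Fin 3) (Fin 3) ℝ) (hU : U.IsSymm) (hS : S.IsSymm)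
    (hB : U * B = S) (hU0 : 0 < ‖U‖) (t : ℝ) (ht : 0 < t) :
    (2 * t * ‖S‖ - t ^ 2 * ‖B‖ ^ 2) / (2 * ‖U‖ + t * ‖B‖) ≤ infDist (U + t • B) (well U) := by
  rw [Metric.le_infDist ⟨U, self_mem_well U⟩]
  intro G hG
  have hpos : 0 < 2 * ‖U‖ + t * ‖B‖ := by positivity
  rw [div_le_iff₀ hpos, dist_eq_norm]
  set F := U + t • B with hF
  have hFn : ‖F‖ ≤ ‖U‖ + t * ‖B‖ := by
    refine (norm_add_le _ _).trans ?_
    rw [norm_smul, Real.norm_of_nonneg ht.le]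
  have hBt : Bᵀ * U = S := by
    have := congrArg Matrix.transpose hB
    rwa [Matrix.transpose_mul, hU.eq, hS.eq] at this
  have e1 : (2 * t) • S = (Fᵀ * (F - G) + (F - G)ᵀ * G) - t ^ 2 • (Bᵀ * B) := by
    have : Fᵀ * (F - G) + (F - G)ᵀ * G = Fᵀ * F - Gᵀ * G := by
      rw [Matrix.transpose_sub, Matrix.mul_sub, Matrix.sub_mul]; abel
    rw [this, well_gram hG, hF]
    simp only [Matrix.transpose_add, Matrix.transpose_smul, Matrix.add_mul, Matrix.mul_add,
      Matrix.smul_mul, Matrix.mul_smul, hU.eq, hBt, hB]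
    module
  have e2 : 2 * t * ‖S‖ ≤ ‖F‖ * ‖F - G‖ + ‖F - G‖ * ‖G‖ + t ^ 2 * (‖B‖ * ‖B‖) := by
    have := congrArg norm e1
    rw [norm_smul, Real.norm_of_nonneg (by positivity)] at this
    rw [this]
    refine (norm_sub_le _ _).trans (add_le_add ((norm_add_le _ _).trans (add_le_add ?_ ?_)) ?_)
    · refine (Matrix.frobenius_norm_mul _ _).trans ?_
      rw [Matrix.frobenius_norm_transpose]
    · refine (Matrix.frobenius_norm_mul _ _).trans ?_
      rw [Matrix.frobenius_norm_transpose]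
    · rw [norm_smul, Real.norm_of_nonneg (by positivity)]
      refine mul_le_mul_of_nonneg_left ((Matrix.frobenius_norm_mul _ _).trans ?_) (by positivity)
      rw [Matrix.frobenius_norm_transpose]
  rw [well_norm hG] at e2
  nlinarith [mul_le_mul_of_nonneg_right hFn (norm_nonneg (F - G))]

open Filter Topology in
/-- Coercivity of the quadratic form `Q(A) = D²W(U)[A,A]`: if `W` is frame indifferent,
`C²` near `SO(3)·U`, vanishes exactly on `SO(3)·U`, is nonnegative, and satisfies the growth
condition `W(F) ≥ c dist²(F, SO(3)·U)` near the well, then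
`Q(U⁻¹ sym A) ≥ λ |sym A|²` for some `λ > 0`. -/
theorem coercivity_second_derivative
    (U : Matrix (Fin 3) (Fin 3) ℝ) (hsymm : U.IsSymm) (hpos : U.PosDef)
    (W : Matrix (Fin 3) (Fin 3) ℝ → ℝ)
    (hframe : ∀ R ∈ Matrix.specialOrthogonalGroup (Fin 3) ℝ,
      ∀ F : Matrix (Fin 3) (Fin 3) ℝ, W (R * F) = W F)
    (hreg : ∃ V : Set (Matrix (Fin 3) (Fin 3) ℝ), IsOpen V ∧ well U ⊆ V ∧ ContDiffOn ℝ 2 W V)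
    (hnonneg : ∀ F, 0 ≤ W F)
    (hmin : ∀ F, W F = 0 ↔ F ∈ well U)
    (hgrowth : ∃ ε > 0, ∃ c > 0, ∀ F : Matrix (Fin 3) (Fin 3) ℝ,
      infDist F (well U) < ε → c * infDist F (well U) ^ 2 ≤ W F) :
    ∃ lam > 0, ∀ A : Matrix (Fin 3) (Fin 3) ℝ,
      lam * ‖symPart A‖ ^ 2 ≤
        iteratedFDeriv ℝ 2 W U ![U⁻¹ * symPart A, U⁻¹ * symPart A] := by
  obtain ⟨V, hV, hUV, hW⟩ := hreg
  obtain ⟨ε, hε, c, hc, hg⟩ := hgrowth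
  have hdet : IsUnit U.det := hpos.det_pos.ne'.isUnit
  have hU0 : 0 < ‖U‖ := by
    rw [norm_pos_iff]
    rintro rfl
    simp at hdet
  refine ⟨2 * c / ‖U‖ ^ 2, by positivity, fun A => ?_⟩
  have hS : (symPart A).IsSymm := by
    unfold symPart
    rw [Matrix.IsSymm, Matrix.transpose_smul, Matrix.transpose_add, Matrix.transpose_transpose,
      add_comm]
  generalize symPart A = S at hS
  have hB : U * (U⁻¹ * S) = S := Matrix.mul_nonsing_inv_cancel_left _ _ hdet
  generalize U⁻¹ * S = B at hB
  have hWat : ContDiffAt ℝ 2 W U := hW.contDiffAt (hV.mem_nhds (hUV (self_mem_well U)))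
  have hWU : W U = 0 := (hmin U).2 (self_mem_well U)
  obtain ⟨hcont, hT⟩ := taylor_gen W U B hWat hnonneg hWU
  by_cases hS0 : S = 0
  · have hB0 : B = 0 := by
      have : U⁻¹ * (U * B) = B := Matrix.nonsing_inv_mul_cancel_left _ _ hdet
      rw [← this, hB, hS0, Matrix.mul_zero]
    have h0 : iteratedFDeriv ℝ 2 W U ![B, B] = 0 :=
      (iteratedFDeriv ℝ 2 W U).map_coord_zero (0 : Fin 2) (by simp [hB0])
    rw [h0]
    simp [hS0]
  have hSp : 0 < ‖S‖ := norm_pos_iff.2 hS0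
  have hL : Tendsto (fun t : ℝ => c * ((2 * ‖S‖ - t * ‖B‖ ^ 2) / (2 * ‖U‖ + t * ‖B‖)) ^ 2)
      (𝓝[>] 0) (𝓝 (c * ((2 * ‖S‖ - 0 * ‖B‖ ^ 2) / (2 * ‖U‖ + 0 * ‖B‖)) ^ 2)) := by
    have : ContinuousAt (fun t : ℝ => c * ((2 * ‖S‖ - t * ‖B‖ ^ 2) / (2 * ‖U‖ + t * ‖B‖)) ^ 2) 0 := by
      have h : 2 * ‖U‖ + 0 * ‖B‖ ≠ 0 := by simp [hU0.ne']
      fun_prop (disch := exact h)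
    exact this.tendsto.mono_left nhdsWithin_le_nhds
  have hsm : ∀ᶠ t : ℝ in 𝓝 0, 0 < 2 * ‖S‖ - t * ‖B‖ ^ 2 := by
    have : ContinuousAt (fun t : ℝ => 2 * ‖S‖ - t * ‖B‖ ^ 2) 0 := by fun_prop
    exact this.eventually (lt_mem_nhds (by simpa using hSp))
  have hfin := le_of_tendsto_of_tendsto hL hT (by
    filter_upwards [self_mem_nhdsWithin, nhdsWithin_le_nhds hsm,
      nhdsWithin_le_nhds (hcont.eventually (Metric.ball_mem_nhds U hε))] with t ht h1 h2
    have ht : 0 < t := ht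
    have h3 := hg (U + t • B) ((Metric.infDist_le_dist_of_mem (self_mem_well U)).trans_lt h2)
    have h4 := dist_bound U S B hsymm hS hB hU0 t ht
    have h5 : (2 * t * ‖S‖ - t ^ 2 * ‖B‖ ^ 2) / (2 * ‖U‖ + t * ‖B‖)
        = t * ((2 * ‖S‖ - t * ‖B‖ ^ 2) / (2 * ‖U‖ + t * ‖B‖)) := by ring
    rw [h5] at h4
    rw [le_div_iff₀ (by positivity)]
    refine le_trans ?_ h3
    have h6 : 0 ≤ (2 * ‖S‖ - t * ‖B‖ ^ 2) / (2 * ‖U‖ + t * ‖B‖) := by positivity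
    have h7 := pow_le_pow_left₀ (by positivity) h4 2
    calc _ = c * (t * ((2 * ‖S‖ - t * ‖B‖ ^ 2) / (2 * ‖U‖ + t * ‖B‖))) ^ 2 := by ring
      _ ≤ _ := mul_le_mul_of_nonneg_left h7 hc.le)
  have h8 : c * ((2 * ‖S‖ - 0 * ‖B‖ ^ 2) / (2 * ‖U‖ + 0 * ‖B‖)) ^ 2
      = (2 * c / ‖U‖ ^ 2 * ‖S‖ ^ 2) / 2 := by
    simp only [zero_mul, sub_zero, add_zero]
    field_simp
  rw [h8] at hfin
  linarith
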